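/- arXiv:0901.1451 — 2 statements merged into one kernel-verified Lean document; each statement's English description precedes it below -/
import Mathlib

section
/- If v and w are adjacent vertices of a marked graph G, then [G] = [G_c^{vw}]; that is, the marked-graph bracket polynomial is invariant under marked pivots. -/
open MvPolynomial

/-- A marked graph: a finite vertex set, an adjacency matrix over GF(2)
(the diagonal entry at `v` is 1 iff `v` carries a loop; for `v ≠ w` the `(v,w)` entry
is 1 iff `v` and `w` are adjacent), a designated set of marked vertices, and a number
of free loops. -/
structure MarkedGraph (V : Type) [Fintype V] [DecidableEq V] where
  adj : Matrix V V (ZMod 2)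
  marked : V → Bool
  freeLoops : ℕ

namespace MarkedGraph

variable {V : Type} [Fintype V] [DecidableEq V]

/-- GF(2)-nullity of a square matrix: the dimension of its kernel. -/
noncomputable def nullity {ι : Type*} [Fintype ι] (M : Matrix ι ι (ZMod 2)) : ℕ :=
  Module.finrank (ZMod 2) (LinearMap.ker M.mulVecLin)

/-- The diagonal matrix `Δ_T` over GF(2) whose diagonal entry at `v` is 1 iff `v ∈ T`. -/
def delta (T : Finset V) : Matrix V V (ZMod 2) :=
  Matrix.diagonal fun v => if v ∈ T then 1 else 0

/-- The vertices kept in the submatrix `𝒜(G)_T`: delete each marked vertex whose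
diagonal entry in `𝒜(G) + Δ_T` is 0. -/
def keep (G : MarkedGraph V) (T : Finset V) : Finset V :=
  Finset.univ.filter fun v => ¬ (G.marked v = true ∧ (G.adj + delta T) v v = 0)

/-- The submatrix `𝒜(G)_T` of `𝒜(G) + Δ_T`. -/
def subMat (G : MarkedGraph V) (T : Finset V) :
    Matrix (G.keep T) (G.keep T) (ZMod 2) :=
  fun i j => (G.adj + delta T) i.1 j.1

/-- The marked-graph bracket polynomial `[G] ∈ ℤ[A,B,d]`, where `A = X 0`, `B = X 1`,
`d = X 2`:  `[G] = d^φ ⬝ Σ_{T ⊆ V(G)} A^(n-|T|) B^(|T|) d^(ν(𝒜(G)_T))`. -/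
noncomputable def bracket (G : MarkedGraph V) : MvPolynomial (Fin 3) ℤ :=
  X 2 ^ G.freeLoops *
    ∑ T : Finset V,
      X 0 ^ (Fintype.card V - T.card) * X 1 ^ T.card * X 2 ^ nullity (G.subMat T)

/-- `x` is a neighbor of `v` (no vertex is a neighbor of itself). -/
def nbr (G : MarkedGraph V) (v x : V) : Prop := x ≠ v ∧ G.adj v x = 1

instance (G : MarkedGraph V) (v x : V) : Decidable (G.nbr v x) :=
  inferInstanceAs (Decidable (x ≠ v ∧ G.adj v x = 1))

/-- Delete the vertices in `s`, together with all incident edges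
(marks and free loops unchanged). -/
def delete (G : MarkedGraph V) (s : Finset V) : MarkedGraph {v : V // v ∉ s} where
  adj := fun i j => G.adj i.1 j.1
  marked := fun i => G.marked i.1
  freeLoops := G.freeLoops

/-- The local complement `G^v`: toggle every entry of the adjacency matrix (diagonal
entries included) whose row and column indices are both neighbors of `v`. -/
def localComp (G : MarkedGraph V) (v : V) : MarkedGraph V :=
  { G with adj := fun x y => if G.nbr v x ∧ G.nbr v y then G.adj x y + 1 else G.adj x y }

/-- `G - {v,v}`: remove the loop at `v` (set the diagonal entry at `v` to 0). -/
def removeLoop (G : MarkedGraph V) (v : V) : MarkedGraph V :=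
  { G with adj := fun x y => if x = v ∧ y = v then 0 else G.adj x y }

/-- `G + I`: toggle all loops. -/
def addI (G : MarkedGraph V) : MarkedGraph V :=
  { G with adj := G.adj + 1 }

/-- `G⁺`: adjoin one free loop. -/
def addFreeLoop (G : MarkedGraph V) : MarkedGraph V :=
  { G with freeLoops := G.freeLoops + 1 }

/-- The condition under which the pivot `G^{vw}` toggles the adjacency between `x`
and `y`: `x` is a neighbor of `v`, `y` is a neighbor of `w`, and either `x` is not a
neighbor of `w` or `y` is not a neighbor of `v`. -/
def pivotCond (G : MarkedGraph V) (v w x y : V) : Prop :=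
  G.nbr v x ∧ G.nbr w y ∧ (¬ G.nbr w x ∨ ¬ G.nbr v y)

instance (G : MarkedGraph V) (v w x y : V) : Decidable (G.pivotCond v w x y) :=
  inferInstanceAs (Decidable (G.nbr v x ∧ G.nbr w y ∧ (¬ G.nbr w x ∨ ¬ G.nbr v y)))

/-- The pivot `G^{vw}`: toggle the adjacency between every pair of distinct vertices
`x, y ∉ {v,w}` such that `x` is a neighbor of `v`, `y` is a neighbor of `w`, and
either `x` is not a neighbor of `w` or `y` is not a neighbor of `v`
(loops are unaffected). -/
def pivot (G : MarkedGraph V) (v w : V) : MarkedGraph V :=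
  { G with adj := fun x y =>
      if x ≠ v ∧ x ≠ w ∧ y ≠ v ∧ y ≠ w ∧ x ≠ y ∧
          (G.pivotCond v w x y ∨ G.pivotCond v w y x)
      then G.adj x y + 1 else G.adj x y }

/-- Interchange the neighbors of `v` and `w` in an adjacency matrix, keeping loops
and the edge between `v` and `w` unchanged. -/
def swapAdjacencies (M : Matrix V V (ZMod 2)) (v w : V) : Matrix V V (ZMod 2) :=
  fun x y =>
    if x = y then M x y
    else if (x = v ∧ y = w) ∨ (x = w ∧ y = v) then M x y
    else M (Equiv.swap v w x) (Equiv.swap v w y)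

/-- The marked pivot `G_c^{vw}`: the pivot `G^{vw}` with the marks on `v` and `w`
toggled and the neighbors of `v` and `w` interchanged (loops, the edge between `v`
and `w`, and free loops unchanged). -/
def markedPivot (G : MarkedGraph V) (v w : V) : MarkedGraph V where
  adj := swapAdjacencies (G.pivot v w).adj v w
  marked := fun u => if u = v ∨ u = w then !(G.marked u) else G.marked u
  freeLoops := G.freeLoops

/-- The disjoint union of two marked graphs: block-diagonal adjacency matrix,
each vertex marked as it was, free loops added. -/
def disjUnion {V₁ V₂ : Type} [Fintype V₁] [DecidableEq V₁] [Fintype V₂] [DecidableEq V₂]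
    (G₁ : MarkedGraph V₁) (G₂ : MarkedGraph V₂) : MarkedGraph (V₁ ⊕ V₂) where
  adj := Matrix.fromBlocks G₁.adj 0 0 G₂.adj
  marked := Sum.elim G₁.marked G₂.marked
  freeLoops := G₁.freeLoops + G₂.freeLoops

/-- Remove the three edges `{u,v}`, `{u,w}`, `{v,w}` (all else unchanged). -/
def removeEdges3 (G : MarkedGraph V) (u v w : V) : MarkedGraph V :=
  { G with adj := fun x y =>
      if (x = u ∧ y = v) ∨ (x = v ∧ y = u) ∨ (x = u ∧ y = w) ∨ (x = w ∧ y = u) ∨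
          (x = v ∧ y = w) ∨ (x = w ∧ y = v)
      then 0 else G.adj x y }

/-- Adjoin one isolated, unmarked vertex with no incident edges; it is looped iff
`loop = true`. -/
def addIsolated (G : MarkedGraph V) (loop : Bool) : MarkedGraph (Option V) where
  adj := fun x y =>
    match x, y with
    | some a, some b => G.adj a b
    | none, none => if loop then 1 else 0
    | _, _ => 0
  marked := fun x => match x with | some a => G.marked a | none => false
  freeLoops := G.freeLoops

/-- The number of vertices of `s` that are adjacent to `x`. -/
def countAdj (G : MarkedGraph V) (x : V) (s : Finset V) : ℕ :=
  (s.filter fun y => G.adj x y = 1).card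

/-- The reduced marked-graph bracket `⟨G⟩ ∈ ℤ[A, A⁻¹]`: substitute `B ↦ A⁻¹` and
`d ↦ -A² - A⁻²` in `[G]`. -/
noncomputable def reducedBracket (G : MarkedGraph V) : LaurentPolynomial ℤ :=
  MvPolynomial.aeval
    ![LaurentPolynomial.T 1, LaurentPolynomial.T (-1),
      -LaurentPolynomial.T 2 - LaurentPolynomial.T (-2)] G.bracket

/-- The number of looped vertices of `G`. -/
def numLoops (G : MarkedGraph V) : ℕ :=
  (Finset.univ.filter fun v => G.adj v v = 1).card

/-- The Jones polynomial `V_G = (-1)^n ⬝ q^(3n-6ℓ) ⬝ ⟨G⟩(q⁻¹)`, as a Laurent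
polynomial in the formal variable `q` (representing `t^(1/4)`); substituting
`A ↦ q⁻¹` in `⟨G⟩` amounts to substituting `A ↦ q⁻¹`, `B ↦ q`, `d ↦ -q² - q⁻²`
in `[G]`. -/
noncomputable def jones (G : MarkedGraph V) : LaurentPolynomial ℤ :=
  (-1) ^ Fintype.card V *
    LaurentPolynomial.T (3 * (Fintype.card V : ℤ) - 6 * (G.numLoops : ℤ)) *
    MvPolynomial.aeval
      ![LaurentPolynomial.T (-1), LaurentPolynomial.T 1,
        -LaurentPolynomial.T 2 - LaurentPolynomial.T (-2)] G.bracket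

end MarkedGraph


namespace MarkedGraph

variable {V : Type} [Fintype V] [DecidableEq V]

/-- adjacency with zero diagonal -/
def adj0 (G : MarkedGraph V) : Matrix V V (ZMod 2) :=
  fun x y => if x = y then 0 else G.adj x y

/-- extension by zero of the kernel of `subMat` -/
def K (G : MarkedGraph V) (T : Finset V) : Submodule (ZMod 2) (V → ZMod 2) where
  carrier := {x | ∀ u, if u ∈ G.keep T then (∑ z, (G.adj + delta T) u z * x z) = 0 else x u = 0}
  add_mem' := by
    intro a b ha hb u
    have h1 := ha u
    have h2 := hb u
    split_ifs at * <;> simp_all [mul_add, Finset.sum_add_distrib]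
  zero_mem' := by
    intro u
    split_ifs <;> simp
  smul_mem' := by
    intro c a ha u
    have h1 := ha u
    split_ifs at *
    · simp only [Pi.smul_apply, smul_eq_mul, mul_left_comm _ c, ← Finset.mul_sum, h1, mul_zero]
    · simp_all

lemma mem_K (G : MarkedGraph V) (T : Finset V) (x : V → ZMod 2) :
    x ∈ G.K T ↔ ∀ u, if u ∈ G.keep T then (∑ z, (G.adj + delta T) u z * x z) = 0
      else x u = 0 := Iff.rfl

lemma sum_keep (G : MarkedGraph V) (T : Finset V) (x : V → ZMod 2)
    (hx : ∀ u, u ∉ G.keep T → x u = 0) (u : V) :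
    (∑ z, (G.adj + delta T) u z * x z) =
      ∑ z : G.keep T, (G.adj + delta T) u z.1 * x z.1 := by
  rw [Finset.sum_coe_sort (G.keep T) (fun z => (G.adj + delta T) u z * x z)]
  symm
  apply Finset.sum_subset (Finset.subset_univ _)
  intro z _ hz
  rw [hx z hz, mul_zero]

lemma nullity_eq (G : MarkedGraph V) (T : Finset V) :
    nullity (G.subMat T) = Module.finrank (ZMod 2) (G.K T) := by
  symm
  unfold nullity
  have h0 : ∀ x : G.K T, ∀ u, u ∉ G.keep T → x.1 u = 0 := by
    intro x u hu
    have := (mem_K G T x.1).1 x.2 u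
    rwa [if_neg hu] at this
  let f : G.K T →ₗ[ZMod 2] LinearMap.ker (G.subMat T).mulVecLin :=
    { toFun := fun x => ⟨fun u => x.1 u.1, by
        rw [LinearMap.mem_ker]
        ext u
        have h1 := (mem_K G T x.1).1 x.2 u.1
        rw [if_pos u.2, sum_keep G T x.1 (h0 x)] at h1
        exact h1⟩
      map_add' := fun _ _ => rfl
      map_smul' := fun _ _ => rfl }
  apply LinearEquiv.finrank_eq
  apply LinearEquiv.ofBijective f
  constructor
  · intro x y hxy
    apply Subtype.ext
    funext u
    by_cases hu : u ∈ G.keep T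
    · exact congrFun (congrArg Subtype.val hxy) ⟨u, hu⟩
    · rw [h0 x u hu, h0 y u hu]
  · intro y
    let x : V → ZMod 2 := fun u => if hu : u ∈ G.keep T then y.1 ⟨u, hu⟩ else 0
    have hx : ∀ u, u ∉ G.keep T → x u = 0 := fun u hu => dif_neg hu
    have hx' : ∀ u : G.keep T, x u.1 = y.1 u := fun u => dif_pos u.2
    refine ⟨⟨x, ?_⟩, ?_⟩
    · rw [mem_K]
      intro u
      split_ifs with hu
      · rw [sum_keep G T x hx]
        simp only [hx']
        exact congrFun (LinearMap.mem_ker.1 y.2) ⟨u, hu⟩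
      · exact hx u hu
    · apply Subtype.ext
      funext u
      exact hx' u

lemma mem_K' (G : MarkedGraph V) (T : Finset V) (x : V → ZMod 2) :
    x ∈ G.K T ↔ ∀ u, if u ∈ G.keep T then
      (∑ z, G.adj0 u z * x z) + (G.adj u u + delta T u u) * x u = 0
      else x u = 0 := by
  rw [mem_K]
  have : ∀ u, (∑ z, (G.adj + delta T) u z * x z) =
      (∑ z, G.adj0 u z * x z) + (G.adj u u + delta T u u) * x u := by
    intro u
    have h : ∀ z, (G.adj + delta T) u z * x z = G.adj0 u z * x z +
        if u = z then (G.adj u u + delta T u u) * x u else 0 := by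
      intro z
      by_cases hz : u = z
      · subst hz; simp [adj0]
      · simp [adj0, hz, delta]
    simp_rw [h, Finset.sum_add_distrib]
    simp
  simp_rw [this]

/-- partial swap -/
def phi (G : MarkedGraph V) (v w : V) : (V → ZMod 2) →ₗ[ZMod 2] (V → ZMod 2) where
  toFun x := fun u => if u = v ∨ u = w then ∑ z, G.adj0 u z * x z else x u
  map_add' := by
    intro a b
    funext u
    by_cases h : u = v ∨ u = w <;> simp [h, mul_add, Finset.sum_add_distrib]
  map_smul' := by
    intro c a
    funext u
    by_cases h : u = v ∨ u = w <;> simp [h, mul_left_comm _ c, ← Finset.mul_sum]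

lemma phi_apply (G : MarkedGraph V) (v w : V) (x : V → ZMod 2) (u : V) :
    G.phi v w x u = if u = v ∨ u = w then ∑ z, G.adj0 u z * x z else x u := rfl

lemma zmod2_cases (a : ZMod 2) : a = 0 ∨ a = 1 := by
  revert a; decide

lemma adj0_v (G : MarkedGraph V) (v w : V) (hsym : G.adj.IsSymm)
    (hvw : v ≠ w) (hadj : G.adj v w = 1) (u : V) :
    (G.markedPivot v w).adj0 v u =
      G.adj0 w u + (if u = v then 1 else 0) + (if u = w then 1 else 0) := by
  have hadj' : G.adj w v = 1 := by rw [← hadj]; exact hsym.apply v w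
  have h2 : (1 : ZMod 2) + 1 = 0 := by decide
  by_cases hv : u = v
  · subst hv; simp [adj0, hadj', hvw, hvw.symm, h2]
  by_cases hw : u = w
  · subst hw; simp [adj0, markedPivot, swapAdjacencies, pivot, hadj, hvw, hvw.symm]
  simp [adj0, markedPivot, swapAdjacencies, pivot, hvw, hv, hw, Ne.symm hv, Ne.symm hw,
    Equiv.swap_apply_of_ne_of_ne hv hw]

lemma adj0_w (G : MarkedGraph V) (v w : V) (hsym : G.adj.IsSymm)
    (hvw : v ≠ w) (hadj : G.adj v w = 1) (u : V) :
    (G.markedPivot v w).adj0 w u =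
      G.adj0 v u + (if u = v then 1 else 0) + (if u = w then 1 else 0) := by
  have hadj' : G.adj w v = 1 := by rw [← hadj]; exact hsym.apply v w
  have h2 : (1 : ZMod 2) + 1 = 0 := by decide
  by_cases hv : u = v
  · subst hv; simp [adj0, markedPivot, swapAdjacencies, pivot, hadj', hvw, hvw.symm]
  by_cases hw : u = w
  · subst hw; simp [adj0, hadj, hvw, hvw.symm, h2]
  simp [adj0, markedPivot, swapAdjacencies, pivot, hvw.symm, hv, hw, Ne.symm hv, Ne.symm hw,
    Equiv.swap_apply_of_ne_of_ne hv hw]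

lemma adj0_other (G : MarkedGraph V) (v w : V) (hsym : G.adj.IsSymm)
    (hvw : v ≠ w) (hadj : G.adj v w = 1) (z : V) (hzv : z ≠ v) (hzw : z ≠ w) (u : V) :
    (G.markedPivot v w).adj0 z u =
      G.adj0 z u + G.adj0 z v * G.adj0 w u + G.adj0 z w * G.adj0 v u
       + G.adj0 z w * (if u = v then 1 else 0) + G.adj0 z v * (if u = w then 1 else 0) := by
  have hadj' : G.adj w v = 1 := by rw [← hadj]; exact hsym.apply v w
  have hz1 : G.adj v z = G.adj z v := hsym.apply z v
  have hz2 : G.adj w z = G.adj z w := hsym.apply z w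
  have h2 : ∀ a : ZMod 2, a + a = 0 := by decide
  have h3 : ∀ a b : ZMod 2, a * b + b * a = 0 := by decide
  by_cases hv : u = v
  · subst hv
    simp [adj0, markedPivot, swapAdjacencies, pivot, hadj', hvw, hvw.symm, hzv, hzw, h2,
      Equiv.swap_apply_of_ne_of_ne hzv hzw]
  by_cases hw : u = w
  · subst hw
    have : ∀ a b : ZMod 2, b = a + b + a := by decide
    simp [adj0, markedPivot, swapAdjacencies, pivot, hadj, hvw, hvw.symm, hzv, hzw, h2,
      Equiv.swap_apply_of_ne_of_ne hzv hzw]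
    try exact this _ _
  by_cases hu : z = u
  · subst hu
    simp [adj0, hzv, hzw, Ne.symm hzv, Ne.symm hzw, hz1, hz2, h3]
  simp only [adj0, markedPivot, swapAdjacencies, pivot, pivotCond, nbr, hz1, hz2, hu, hzv, hzw,
    hv, hw, Ne.symm hv, Ne.symm hw,
      Equiv.swap_apply_of_ne_of_ne hzv hzw, Equiv.swap_apply_of_ne_of_ne hv hw]
  generalize G.adj z v = a
  generalize G.adj z w = b
  generalize G.adj v u = c
  generalize G.adj w u = d
  generalize G.adj z u = e
  simp [hzv, hzw, hv, hw, hu]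
  clear * -
  revert a b c d e
  decide

lemma sum_phi (G : MarkedGraph V) (v w : V) (hvw : v ≠ w) (x : V → ZMod 2) (u : V) :
    ∑ z, G.adj0 u z * G.phi v w x z = (∑ z, G.adj0 u z * x z)
      + G.adj0 u v * ((∑ z, G.adj0 v z * x z) + x v)
      + G.adj0 u w * ((∑ z, G.adj0 w z * x z) + x w) := by
  have h2 : ∀ a b : ZMod 2, a = b + (a + b) := by decide
  have h : ∀ z, G.adj0 u z * G.phi v w x z = G.adj0 u z * x z
      + (if z = v then G.adj0 u v * ((∑ z, G.adj0 v z * x z) + x v) else 0)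
      + (if z = w then G.adj0 u w * ((∑ z, G.adj0 w z * x z) + x w) else 0) := by
    intro z
    rw [phi_apply]
    by_cases hv : z = v
    · subst hv
      simp only [true_or, if_true, if_neg hvw, add_zero, ← mul_add, ← h2]
    by_cases hw : z = w
    · subst hw
      simp only [or_true, if_true, if_neg hv, add_zero, ← mul_add, ← h2]
    simp [hv, hw]
  simp_rw [h, Finset.sum_add_distrib]
  simp

lemma key (G : MarkedGraph V) (v w : V) (hsym : G.adj.IsSymm)
    (hvw : v ≠ w) (hadj : G.adj v w = 1) (x : V → ZMod 2) (u : V) :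
    ∑ z, (G.markedPivot v w).adj0 u z * G.phi v w x z =
      if u = v ∨ u = w then x u else ∑ z, G.adj0 u z * x z := by
  have hadj' : G.adj w v = 1 := by rw [← hadj]; exact hsym.apply v w
  have e1 : G.adj0 v w = 1 := by simp [adj0, hvw, hadj]
  have e2 : G.adj0 w v = 1 := by simp [adj0, hvw.symm, hadj']
  have e3 : G.adj0 v v = 0 := by simp [adj0]
  have e4 : G.adj0 w w = 0 := by simp [adj0]
  have pv : G.phi v w x v = ∑ z, G.adj0 v z * x z := by simp [phi_apply]
  have pw : G.phi v w x w = ∑ z, G.adj0 w z * x z := by simp [phi_apply]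
  by_cases hv : u = v
  · subst hv
    simp_rw [adj0_v G u w hsym hvw hadj, add_mul, Finset.sum_add_distrib]
    rw [sum_phi G u w hvw]
    simp only [ite_mul, one_mul, zero_mul, Finset.sum_ite_eq', Finset.mem_univ, if_true, pv, pw,
      e2, e4, true_or]
    generalize (∑ z, G.adj0 u z * x z) = a
    generalize (∑ z, G.adj0 w z * x z) = b
    generalize x u = c
    revert a b c; decide
  by_cases hw : u = w
  · subst hw
    simp_rw [adj0_w G v u hsym hvw hadj, add_mul, Finset.sum_add_distrib]
    rw [sum_phi G v u hvw]
    simp only [ite_mul, one_mul, zero_mul, Finset.sum_ite_eq', Finset.mem_univ, if_true, pv, pw,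
      e1, e3, or_true]
    generalize (∑ z, G.adj0 u z * x z) = a
    generalize (∑ z, G.adj0 v z * x z) = b
    generalize x u = c
    revert a b c; decide
  simp_rw [adj0_other G v w hsym hvw hadj u hv hw, add_mul, Finset.sum_add_distrib, mul_assoc,
    ← Finset.mul_sum]
  rw [sum_phi G v w hvw, sum_phi G v w hvw, sum_phi G v w hvw]
  simp only [ite_mul, one_mul, zero_mul, Finset.sum_ite_eq', Finset.mem_univ, if_true, pv, pw,
      e1, e2, e3, e4, hv, hw, or_self, if_false]
  generalize (∑ z, G.adj0 u z * x z) = a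
  generalize (∑ z, G.adj0 v z * x z) = b
  generalize (∑ z, G.adj0 w z * x z) = c
  generalize G.adj0 u v = p
  generalize G.adj0 u w = q
  generalize x v = r
  generalize x w = s
  have h2 : (2 : ZMod 2) = 0 := by decide
  linear_combination (p * b + p * r + p * c + q * c + q * s + q * b) * h2

lemma phi_phi (G : MarkedGraph V) (v w : V) (hsym : G.adj.IsSymm)
    (hvw : v ≠ w) (hadj : G.adj v w = 1) (x : V → ZMod 2) :
    (G.markedPivot v w).phi v w (G.phi v w x) = x := by
  funext u
  rw [phi_apply, key G v w hsym hvw hadj, phi_apply]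
  split_ifs <;> rfl

lemma diag_eq (G : MarkedGraph V) (v w u : V) :
    (G.markedPivot v w).adj u u = G.adj u u := by
  simp [markedPivot, swapAdjacencies, pivot]

lemma mem_keep (G : MarkedGraph V) (T : Finset V) (u : V) :
    u ∈ G.keep T ↔ ¬ (G.marked u = true ∧ G.adj u u + delta T u u = 0) := by
  unfold keep
  rw [Finset.mem_filter]
  exact and_iff_right (Finset.mem_univ u)

lemma mem_phi (G : MarkedGraph V) (v w : V) (hsym : G.adj.IsSymm)
    (hvw : v ≠ w) (hadj : G.adj v w = 1) (T : Finset V) (x : V → ZMod 2) :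
    G.phi v w x ∈ (G.markedPivot v w).K T ↔ x ∈ G.K T := by
  rw [mem_K', mem_K']
  apply forall_congr'
  intro u
  rw [key G v w hsym hvw hadj, phi_apply, diag_eq]
  have k1 : (u ∈ (G.markedPivot v w).keep T) =
      ¬ ((G.markedPivot v w).marked u = true ∧ G.adj u u + delta T u u = 0) := by
    rw [mem_keep, diag_eq]
  have k2 : (u ∈ G.keep T) = ¬ (G.marked u = true ∧ G.adj u u + delta T u u = 0) := by
    rw [mem_keep]
  simp only [k1, k2]
  clear k1 k2
  by_cases h : u = v ∨ u = w
  · simp only [markedPivot, h, if_true]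
    rcases zmod2_cases (G.adj u u + delta T u u) with ht | ht <;> rw [ht] <;>
      cases G.marked u <;> simp [add_comm]
  · simp only [markedPivot, h, if_false]

lemma nullity_pivot (G : MarkedGraph V) (v w : V) (hsym : G.adj.IsSymm)
    (hvw : v ≠ w) (hadj : G.adj v w = 1) (T : Finset V) :
    nullity (G.subMat T) = nullity ((G.markedPivot v w).subMat T) := by
  rw [nullity_eq, nullity_eq]
  have hinj : Function.Injective (G.phi v w) :=
    Function.LeftInverse.injective (phi_phi G v w hsym hvw hadj)
  let e := LinearEquiv.ofInjectiveEndo (G.phi v w) hinj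
  have he : ∀ x, e x = G.phi v w x := fun x => rfl
  rw [← LinearEquiv.finrank_map_eq e (G.K T)]
  suffices hK : (G.K T).map (e : (V → ZMod 2) →ₗ[ZMod 2] (V → ZMod 2)) =
      (G.markedPivot v w).K T by rw [hK]
  ext y
  obtain ⟨x, rfl⟩ := e.surjective y
  rw [he, mem_phi G v w hsym hvw hadj, ← he]
  constructor
  · rintro ⟨x', hx', h⟩
    rwa [← e.injective h]
  · exact fun hx => ⟨x, hx, rfl⟩

end MarkedGraph

/-- The marked-graph bracket is invariant under marked pivots:
if `v` and `w` are adjacent then `[G] = [G_c^{vw}]`. -/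
theorem bracket_markedPivot {V : Type} [Fintype V] [DecidableEq V]
    (G : MarkedGraph V) (hsym : G.adj.IsSymm) (v w : V)
    (hvw : v ≠ w) (hadj : G.adj v w = 1) :
    G.bracket = (G.markedPivot v w).bracket := by
  unfold MarkedGraph.bracket
  simp_rw [MarkedGraph.nullity_pivot G v w hsym hvw hadj]
  rfl
end

section
/- Suppose G is a marked graph with two adjacent vertices v and w such that v is looped and marked, w is neither looped nor marked, and v is the only neighbor of w. If v has no neighbor other than w, then ⟨G⟩ = ⟨G⁺ − v − w⟩, where G⁺ is obtained from G by adjoining one free loop. Otherwise, for any neighbor z ≠ w of v, ⟨G⟩ = ⟨G_c^{vz} − v − w⟩. -/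
open MvPolynomial

namespace MarkedGraph

set_option linter.unusedSectionVars false
set_option linter.unusedSimpArgs false

section helpers

variable {V : Type} [Fintype V] [DecidableEq V]

/-- Vectors supported on `k` that are annihilated by the rows in `k` of `D`. -/
def NL (D : Matrix V V (ZMod 2)) (k : Finset V) : Submodule (ZMod 2) (V → ZMod 2) where
  carrier := {x | (∀ i ∈ k, D.mulVec x i = 0) ∧ ∀ i, i ∉ k → x i = 0}
  zero_mem' := by simp
  add_mem' := by
    rintro x y ⟨h1, h2⟩ ⟨h3, h4⟩
    refine ⟨fun i hi => ?_, fun i hi => ?_⟩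
    · rw [Matrix.mulVec_add, Pi.add_apply, h1 i hi, h3 i hi, add_zero]
    · rw [Pi.add_apply, h2 i hi, h4 i hi, add_zero]
  smul_mem' := by
    rintro c x ⟨h1, h2⟩
    refine ⟨fun i hi => ?_, fun i hi => ?_⟩
    · rw [Matrix.mulVec_smul, Pi.smul_apply, h1 i hi, smul_zero]
    · rw [Pi.smul_apply, h2 i hi, smul_zero]

theorem mem_NL {D : Matrix V V (ZMod 2)} {k : Finset V} {x : V → ZMod 2} :
    x ∈ NL D k ↔ (∀ i ∈ k, D.mulVec x i = 0) ∧ ∀ i, i ∉ k → x i = 0 := Iff.rfl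

/-- The dimension of `NL`. -/
noncomputable def nl (D : Matrix V V (ZMod 2)) (k : Finset V) : ℕ :=
  Module.finrank (ZMod 2) (NL D k)

theorem finrank_eq_of_maps {W₁ W₂ : Type*} [AddCommGroup W₁] [AddCommGroup W₂]
    [Module (ZMod 2) W₁] [Module (ZMod 2) W₂]
    (K₁ : Submodule (ZMod 2) W₁) (K₂ : Submodule (ZMod 2) W₂)
    (f : W₁ →ₗ[ZMod 2] W₂) (g : W₂ →ₗ[ZMod 2] W₁)
    (hf : ∀ x ∈ K₁, f x ∈ K₂) (hgf : ∀ x ∈ K₁, g (f x) = x)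
    (hg : ∀ x ∈ K₂, g x ∈ K₁) (hfg : ∀ x ∈ K₂, f (g x) = x) :
    Module.finrank (ZMod 2) K₁ = Module.finrank (ZMod 2) K₂ := by
  refine LinearEquiv.finrank_eq (LinearEquiv.ofLinearMap (f.restrict hf) (g.restrict hg) ?_ ?_)
  · ext x
    simpa using hfg x x.2
  · ext x
    simpa using hgf x x.2

theorem nullity_sub {ι : Type*} [Fintype ι] (e : ι → V) (he : Function.Injective e)
    (D : Matrix V V (ZMod 2)) (k : Finset V) (hk : ∀ i, i ∈ k ↔ i ∈ Set.range e)
    (M : Matrix ι ι (ZMod 2)) (hM : ∀ i j, M i j = D (e i) (e j)) :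
    nullity M = nl D k := by
  have key : ∀ x : V → ZMod 2, (∀ i, i ∉ k → x i = 0) → ∀ i,
      M.mulVec (x ∘ e) i = D.mulVec x (e i) := by
    intro x hx i
    simp only [Matrix.mulVec, dotProduct]
    refine Fintype.sum_of_injective e he _ _ ?_ ?_
    · intro j hj
      rw [hx j (fun h => hj ((hk j).1 h)), mul_zero]
    · intro j
      simp [hM]
  have hext : ∀ y : ι → ZMod 2, (Function.extend e y 0) ∘ e = y := by
    intro y
    funext i
    simp [he.extend_apply]
  have hext0 : ∀ (y : ι → ZMod 2) i, i ∉ k → Function.extend e y 0 i = 0 := by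
    intro y i hi
    rw [Function.extend_apply']
    · rfl
    · exact fun h => hi ((hk i).2 h)
  unfold nullity nl
  refine finrank_eq_of_maps _ _ (Function.ExtendByZero.linearMap (ZMod 2) e)
    (LinearMap.funLeft (ZMod 2) (ZMod 2) e) ?_ ?_ ?_ ?_
  · intro y hy
    have hy' : M.mulVec y = 0 := by simpa using hy
    refine mem_NL.2 ⟨?_, hext0 y⟩
    intro i hi
    obtain ⟨a, rfl⟩ := (hk i).1 hi
    change D.mulVec (Function.extend e y 0) (e a) = 0
    rw [← key _ (hext0 y), hext, hy']
    rfl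
  · intro y _
    exact hext y
  · intro x hx
    rw [mem_NL] at hx
    have : M.mulVec (x ∘ e) = 0 := by
      funext a
      rw [key x hx.2, hx.1 _ ((hk _).2 ⟨a, rfl⟩)]
      rfl
    rw [LinearMap.mem_ker]
    exact this
  · intro x hx
    rw [mem_NL] at hx
    funext i
    change Function.extend e (x ∘ e) 0 i = x i
    by_cases hi : i ∈ k
    · obtain ⟨a, rfl⟩ := (hk i).1 hi
      simp [he.extend_apply]
    · rw [hext0 _ i hi, hx.2 i hi]

theorem nl_congr (D D' : Matrix V V (ZMod 2)) (k : Finset V)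
    (h : ∀ i ∈ k, ∀ j ∈ k, D i j = D' i j) : nl D k = nl D' k := by
  have : NL D k = NL D' k := by
    ext x
    rw [mem_NL, mem_NL]
    refine and_congr_left fun hx => forall_congr' fun i => forall_congr' fun hi => ?_
    have : D.mulVec x i = D'.mulVec x i := by
      simp only [Matrix.mulVec, dotProduct]
      refine Finset.sum_congr rfl fun j _ => ?_
      by_cases hj : j ∈ k
      · rw [h i hi j hj]
      · rw [hx j hj, mul_zero, mul_zero]
    rw [this]
  rw [nl, nl, this]

/-- add to the coordinate `u` the value of the functional `l`. -/
def addAt (u : V) (l : (V → ZMod 2) →ₗ[ZMod 2] ZMod 2) :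
    (V → ZMod 2) →ₗ[ZMod 2] (V → ZMod 2) :=
  LinearMap.id + (LinearMap.single (ZMod 2) (fun _ => ZMod 2) u).comp l

theorem addAt_apply (u : V) (l : (V → ZMod 2) →ₗ[ZMod 2] ZMod 2) (x : V → ZMod 2) (i : V) :
    addAt u l x i = x i + if i = u then l x else 0 := by
  simp [addAt, Pi.single_apply]

theorem mulVec_addAt (D : Matrix V V (ZMod 2)) (u : V)
    (l : (V → ZMod 2) →ₗ[ZMod 2] ZMod 2) (x : V → ZMod 2) (i : V) :
    D.mulVec (addAt u l x) i = D.mulVec x i + D i u * l x := by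
  simp [addAt, Matrix.mulVec_add, mul_comm]

/-- row functional -/
def rowF (D : Matrix V V (ZMod 2)) (i : V) : (V → ZMod 2) →ₗ[ZMod 2] ZMod 2 :=
  (LinearMap.proj i).comp D.mulVecLin

theorem rowF_apply (D : Matrix V V (ZMod 2)) (i : V) (x : V → ZMod 2) :
    rowF D i x = D.mulVec x i := by simp [rowF]

/-- coordinate functional -/
def coordF (i : V) : (V → ZMod 2) →ₗ[ZMod 2] ZMod 2 := LinearMap.proj i

theorem coordF_apply (i : V) (x : V → ZMod 2) :
    coordF i x = x i := rfl

theorem z2_self (a : ZMod 2) : a + a = 0 := by revert a; decide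

theorem mulVec_rank1 (D : Matrix V V (ZMod 2)) (c : V → ZMod 2) (p : V) (x : V → ZMod 2) (i : V) :
    Matrix.mulVec (Matrix.of fun i j => c i * D p j) x i = c i * D.mulVec x p := by
  simp only [Matrix.mulVec, dotProduct, Matrix.of_apply, Finset.mul_sum, mul_assoc]

theorem nl_P1 (D D' : Matrix V V (ZMod 2)) (k : Finset V) (u : V) (hu : u ∉ k)
    (huu : D u u = 1) (h : ∀ i ∈ k, ∀ j ∈ k, D' i j = D i j + D i u * D u j) :
    nl D (insert u k) = nl D' k := by
  rw [nl_congr D' (D + Matrix.of fun i j => D i u * D u j) k (by simpa using h)]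
  have key : ∀ x i, Matrix.mulVec (D + Matrix.of fun i j => D i u * D u j) x i =
      D.mulVec x i + D i u * D.mulVec x u := by
    intro x i
    rw [Matrix.add_mulVec, Pi.add_apply, mulVec_rank1 D (fun i => D i u) u]
  unfold nl
  refine finrank_eq_of_maps _ _ (addAt u (coordF u)) (addAt u (rowF D u)) ?_ ?_ ?_ ?_
  · intro x hx
    rw [mem_NL] at hx ⊢
    refine ⟨fun i hi => ?_, fun i hi => ?_⟩
    · rw [key, mulVec_addAt, mulVec_addAt, hx.1 i (by simp [hi]), hx.1 u (by simp), huu,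
        coordF_apply]
      have := z2_self (D i u * x u)
      linear_combination this
    · rw [addAt_apply, coordF_apply]
      by_cases h : i = u
      · subst h; simp [z2_self]
      · simp [h, hx.2 i (by simp [h, hi])]
  · intro x hx
    rw [mem_NL] at hx
    funext i
    rw [addAt_apply, addAt_apply, rowF_apply, mulVec_addAt, hx.1 u (by simp), huu, coordF_apply]
    by_cases h : i = u
    · subst h
      have := z2_self (x i)
      simp
      linear_combination this
    · simp [h]
  · intro x hx
    rw [mem_NL] at hx ⊢
    simp only [key] at hx
    refine ⟨fun i hi => ?_, fun i hi => ?_⟩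
    · rw [mulVec_addAt, rowF_apply]
      by_cases h : i = u
      · subst h; rw [huu, one_mul, z2_self]
      · exact hx.1 i (by simpa [h] using hi)
    · simp only [Finset.mem_insert, not_or] at hi
      simp [addAt_apply, hi.1, hx.2 i hi.2]
  · intro x hx
    rw [mem_NL] at hx
    funext i
    rw [addAt_apply, addAt_apply, coordF_apply, rowF_apply, addAt_apply, rowF_apply, hx.2 u hu]
    by_cases h : i = u
    · subst h
      simp [hx.2 i hu, z2_self]
    · simp [h]

theorem nl_P2 (D D' : Matrix V V (ZMod 2)) (k : Finset V) (p q : V) (hpq : p ≠ q)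
    (hp : p ∉ k) (hq : q ∉ k)
    (hpp : D p p = 0) (h1 : D p q = 1) (h2 : D q p = 1)
    (h : ∀ i ∈ k, ∀ j ∈ k, D' i j =
      D i j + D q q * D i p * D p j + D i p * D q j + D i q * D p j) :
    nl D (insert p (insert q k)) = nl D' k := by
  rw [nl_congr D' (D + (Matrix.of fun i j => (D q q * D i p + D i q) * D p j) +
    (Matrix.of fun i j => D i p * D q j)) k (by
      intro i hi j hj
      simp only [h i hi j hj, Matrix.add_apply, Matrix.of_apply]
      ring)]
  have key : ∀ x i, Matrix.mulVec (D + (Matrix.of fun i j => (D q q * D i p + D i q) * D p j) +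
    (Matrix.of fun i j => D i p * D q j)) x i =
      D.mulVec x i + (D q q * D i p + D i q) * D.mulVec x p + D i p * D.mulVec x q := by
    intro x i
    rw [Matrix.add_mulVec, Pi.add_apply, Matrix.add_mulVec, Pi.add_apply,
      mulVec_rank1 D (fun i => D q q * D i p + D i q) p, mulVec_rank1 D (fun i => D i p) q]
  have hqp : q ≠ p := hpq.symm
  unfold nl
  refine finrank_eq_of_maps _ _ ((addAt p (coordF p)).comp (addAt q (coordF q)))
    ((addAt p (rowF D q)).comp (addAt q (rowF D p))) ?_ ?_ ?_ ?_
  · intro x hx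
    rw [mem_NL] at hx ⊢
    refine ⟨fun i hi => ?_, fun i hi => ?_⟩
    · simp only [key, LinearMap.comp_apply, mulVec_addAt, coordF_apply, addAt_apply, if_neg hpq]
      rw [hx.1 i (by simp [hi]), hx.1 p (by simp), hx.1 q (by simp), hpp, h1, h2]
      have e1 := z2_self (D i q * x q)
      have e2 := z2_self (D i p * x p)
      have e3 := z2_self (D q q * D i p * x q)
      linear_combination e1 + e2 + e3
    · simp only [LinearMap.comp_apply, coordF_apply, addAt_apply, if_neg hpq]
      by_cases h : i = p
      · subst h; simp [hpq, z2_self]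
      · by_cases h' : i = q
        · subst h'; simp [hqp, z2_self]
        · simp [h, h', hx.2 i (by simp [h, h', hi])]
  · intro x hx
    rw [mem_NL] at hx
    have hp1 := hx.1 p (by simp)
    have hq1 := hx.1 q (by simp)
    funext i
    simp only [LinearMap.comp_apply, mulVec_addAt, coordF_apply, rowF_apply, addAt_apply,
      if_neg hpq, hp1, hq1, hpp, h1, h2]
    by_cases h : i = p
    · subst h
      simp [hpq]
      have e1 := z2_self (D q q * x q)
      have e2 := z2_self (x i)
      linear_combination e1 + e2
    · by_cases h' : i = q
      · subst h'
        simp [hqp]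
        linear_combination z2_self (x i)
      · simp [h, h']
  · intro x hx
    rw [mem_NL] at hx ⊢
    simp only [key] at hx
    refine ⟨fun i hi => ?_, fun i hi => ?_⟩
    · simp only [LinearMap.comp_apply, mulVec_addAt, rowF_apply]
      by_cases h : i = p
      · subst h
        rw [hpp, h1]
        linear_combination z2_self (D.mulVec x i)
      · by_cases h' : i = q
        · subst h'
          rw [h2]
          linear_combination z2_self (D.mulVec x i) + z2_self (D i i * D.mulVec x p)
        · have := hx.1 i (by simpa [h, h'] using hi)
          linear_combination this
    · simp only [Finset.mem_insert, not_or] at hi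
      simp [addAt_apply, hi.1, hi.2.1, hx.2 i hi.2.2]
  · intro x hx
    rw [mem_NL] at hx
    funext i
    simp only [LinearMap.comp_apply, mulVec_addAt, coordF_apply, rowF_apply, addAt_apply,
      if_neg hpq, if_neg hqp, hx.2 p hp, hx.2 q hq]
    by_cases h : i = p
    · subst h
      simp [hpq, hx.2 i hp, z2_self]
    · by_cases h' : i = q
      · subst h'
        simp [hqp, hx.2 i hq, z2_self]
      · simp [h, h']

theorem nl_P0 (D D' : Matrix V V (ZMod 2)) (k : Finset V) (u : V) (hu : u ∉ k)
    (huu : D u u = 0) (h1 : ∀ i ∈ k, D u i = 0) (h2 : ∀ i ∈ k, D i u = 0)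
    (h : ∀ i ∈ k, ∀ j ∈ k, D' i j = D i j) :
    nl D (insert u k) = nl D' k + 1 := by
  rw [nl_congr D' D k h]
  have e : Module.finrank (ZMod 2) (NL D k) + 1 =
      Module.finrank (ZMod 2) ((NL D k).prod (⊤ : Submodule (ZMod 2) (ZMod 2))) := by
    let E : (NL D k × ZMod 2) ≃ₗ[ZMod 2] ((NL D k).prod (⊤ : Submodule (ZMod 2) (ZMod 2))) :=
      { toFun := fun x => ⟨(x.1.1, x.2), ⟨x.1.2, trivial⟩⟩
        invFun := fun x => (⟨x.1.1, x.2.1⟩, x.1.2)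
        map_add' := fun x y => rfl
        map_smul' := fun c x => rfl
        left_inv := fun x => rfl
        right_inv := fun x => rfl }
    rw [← E.finrank_eq, Module.finrank_prod, Module.finrank_self]
  unfold nl
  rw [e]
  refine finrank_eq_of_maps _ _ ((addAt u (coordF u)).prod (coordF u))
    (LinearMap.coprod LinearMap.id (LinearMap.single (ZMod 2) (fun _ => ZMod 2) u)) ?_ ?_ ?_ ?_
  · intro x hx
    rw [mem_NL] at hx
    rw [Submodule.mem_prod]
    refine ⟨mem_NL.2 ⟨fun i hi => ?_, fun i hi => ?_⟩, trivial⟩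
    · simp [mulVec_addAt, hx.1 i (by simp [hi]), h2 i hi]
    · simp only [LinearMap.prod_apply, Function.prod_apply, addAt_apply, coordF_apply]
      by_cases h : i = u
      · subst h; simp [z2_self]
      · simp [h, hx.2 i (by simp [h, hi])]
  · intro x hx
    funext i
    simp only [LinearMap.prod_apply, Function.prod_apply, LinearMap.coprod_apply, Pi.add_apply,
      LinearMap.id_apply, addAt_apply, coordF_apply, LinearMap.single_apply, Pi.single_apply]
    by_cases h : i = u
    · subst h; simp [add_assoc, z2_self]
    · simp [h]
  · rintro ⟨x, c⟩ hx
    rw [Submodule.mem_prod] at hx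
    replace hx := mem_NL.1 hx.1
    simp only at hx
    rw [mem_NL]
    refine ⟨fun i hi => ?_, fun i hi => ?_⟩
    · simp only [LinearMap.coprod_apply, LinearMap.id_apply, LinearMap.single_apply,
        Matrix.mulVec_add, Pi.add_apply]
      by_cases h : i = u
      · subst h
        have : D.mulVec x i = 0 := by
          simp only [Matrix.mulVec, dotProduct]
          refine Finset.sum_eq_zero fun j _ => ?_
          by_cases hj : j ∈ k
          · rw [h1 j hj, zero_mul]
          · rw [hx.2 j hj, mul_zero]
        simp [this, huu]
      · have hi' : i ∈ k := by simpa [h] using hi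
        simp [hx.1 i hi', h2 i hi']
    · simp only [Finset.mem_insert, not_or] at hi
      simp [hi.1, hx.2 i hi.2]
  · rintro ⟨x, c⟩ hx
    rw [Submodule.mem_prod] at hx
    replace hx := mem_NL.1 hx.1
    simp only at hx
    refine Prod.ext ?_ ?_
    · funext i
      simp only [LinearMap.prod_apply, Function.prod_apply, LinearMap.coprod_apply, Pi.add_apply,
        LinearMap.id_apply, addAt_apply, coordF_apply, LinearMap.single_apply, Pi.single_apply]
      by_cases h : i = u
      · subst h
        simp [hx.2 i hu, z2_self]
      · simp [h]
    · simp [coordF_apply, hx.2 u hu]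

theorem nl_cong (D D' : Matrix V V (ZMod 2)) (k : Finset V) (v : V)
    (hv : v ∉ k) (s s' : V → ZMod 2) (hvv : D v v = 0) (hvv' : D' v v = 0)
    (h1 : ∀ i ∈ k, D' v i = D v i) (h2 : ∀ i ∈ k, D' i v = D i v)
    (h : ∀ i ∈ k, ∀ j ∈ k, D' i j = D i j + D i v * s j + s' i * D v j) :
    nl D (insert v k) = nl D' (insert v k) := by
  obtain ⟨t, ht⟩ : ∃ t : V → ZMod 2, t = fun j => if j ∈ k then s j else 0 := ⟨_, rfl⟩
  obtain ⟨t', ht'⟩ : ∃ t : V → ZMod 2, t = fun j => if j ∈ k then s' j else 0 := ⟨_, rfl⟩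
  have htv : t v = 0 := by simp [ht, hv]
  have htv' : t' v = 0 := by simp [ht', hv]
  obtain ⟨M, hM⟩ : ∃ M : Matrix V V (ZMod 2), M = Matrix.of fun _ j => t j := ⟨_, rfl⟩
  have hMv : M v v = 0 := by simp [hM, htv]
  rw [nl_congr D' (D + (Matrix.of fun i j => D i v * M v j) +
    (Matrix.of fun i j => t' i * D v j)) (insert v k) (by
      intro i hi j hj
      simp only [Matrix.add_apply, Matrix.of_apply]
      rcases Finset.mem_insert.1 hi with hi | hi
      · rcases Finset.mem_insert.1 hj with hj | hj
        · simp [hi, hj, hvv, hvv']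
        · simp [hi, hvv, htv', h1 j hj]
      · rcases Finset.mem_insert.1 hj with hj | hj
        · simp [hj, hvv, hMv, h2 i hi]
        · simp [h i hi j hj, hM, ht, ht', hi, hj])]
  have key : ∀ x i, Matrix.mulVec (D + (Matrix.of fun i j => D i v * M v j) +
    (Matrix.of fun i j => t' i * D v j)) x i =
      D.mulVec x i + D i v * M.mulVec x v + t' i * D.mulVec x v := by
    intro x i
    rw [Matrix.add_mulVec, Pi.add_apply, Matrix.add_mulVec, Pi.add_apply,
      mulVec_rank1 M (fun i => D i v) v, mulVec_rank1 D t' v]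
  have inv : ∀ x, addAt v (rowF M v) (addAt v (rowF M v) x) = x := by
    intro x
    funext i
    simp only [addAt_apply, rowF_apply, mulVec_addAt, hMv]
    by_cases h : i = v
    · simp only [h, if_true]
      linear_combination z2_self (M.mulVec x v)
    · simp [h]
  have hsup : ∀ x : V → ZMod 2, (∀ i, i ∉ insert v k → x i = 0) →
      ∀ i, i ∉ insert v k → addAt v (rowF M v) x i = 0 := by
    intro x hx i hi
    have : i ≠ v := fun h => hi (by simp [h])
    simp [addAt_apply, hx i hi, this]
  unfold nl
  refine finrank_eq_of_maps _ _ (addAt v (rowF M v)) (addAt v (rowF M v)) ?_ (fun x _ => inv x) ?_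
    (fun x _ => inv x)
  · intro x hx
    rw [mem_NL] at hx ⊢
    refine ⟨fun i hi => ?_, hsup x hx.2⟩
    simp only [key, mulVec_addAt, rowF_apply, hMv, hvv, hx.1 i hi, hx.1 v (by simp)]
    linear_combination z2_self (D i v * M.mulVec x v)
  · intro x hx
    rw [mem_NL] at hx ⊢
    simp only [key] at hx
    refine ⟨fun i hi => ?_, hsup x hx.2⟩
    have h0 := hx.1 v (by simp)
    have h1 := hx.1 i hi
    simp only [hvv, htv', zero_mul, add_zero] at h0
    simp only [mulVec_addAt, rowF_apply]
    linear_combination h1 - t' i * h0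

theorem nl_reindex (D : Matrix V V (ZMod 2)) (k k' : Finset V) (σ : V ≃ V)
    (hk : ∀ i, i ∈ k' ↔ σ i ∈ k) : nl D k = nl (D.submatrix σ σ) k' := by
  rw [← nullity_sub (fun i : k' => (i : V)) Subtype.val_injective (D.submatrix σ σ) k'
    (by simp) (fun i j => D (σ i) (σ j)) (fun i j => rfl)]
  symm
  refine nullity_sub (fun i : k' => σ i) ?_ D k ?_ _ (fun i j => rfl)
  · intro a b h
    exact Subtype.ext (σ.injective h)
  · intro i
    constructor
    · intro hi
      exact ⟨⟨σ.symm i, (hk _).2 (by simpa using hi)⟩, by simp⟩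
    · rintro ⟨a, rfl⟩
      exact (hk _).1 a.2

/-- Replacing the border vertex `v` by `z`. -/
theorem nl_P3 (D D' : Matrix V V (ZMod 2)) (k : Finset V) (v z : V) (hvz : v ≠ z)
    (hv : v ∉ k) (hz : z ∉ k) (s s' : V → ZMod 2)
    (hvv : D v v = 0) (hzz : D' z z = 0)
    (h1 : ∀ i ∈ k, D' z i = D v i) (h2 : ∀ i ∈ k, D' i z = D i v)
    (h : ∀ i ∈ k, ∀ j ∈ k, D' i j = D i j + D i v * s j + s' i * D v j) :
    nl D (insert v k) = nl D' (insert z k) := by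
  have hne : ∀ i ∈ k, Equiv.swap v z i = i := fun i hi =>
    Equiv.swap_apply_of_ne_of_ne (fun h => hv (h ▸ hi)) (fun h => hz (h ▸ hi))
  rw [nl_reindex D' (insert z k) (insert v k) (Equiv.swap v z)]
  · apply nl_cong D _ k v hv s s' hvv
    · simp [hzz]
    · intro i hi
      simp [hne i hi, h1 i hi]
    · intro i hi
      simp [hne i hi, h2 i hi]
    · intro i hi j hj
      simp [hne i hi, hne j hj, h i hi j hj]
  · intro i
    by_cases hiv : i = v
    · simp [hiv]
    · by_cases hiz : i = z
      · subst hiz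
        simp [hiv, hv, hz, hvz]
      · rw [Equiv.swap_apply_of_ne_of_ne hiv hiz]
        simp [hiv, hiz]

theorem nullity_subMat (G : MarkedGraph V) (T : Finset V) :
    nullity (G.subMat T) = nl (G.adj + delta T) (G.keep T) :=
  nullity_sub (fun i : G.keep T => (i : V)) Subtype.val_injective _ _ (by simp) _
    (fun _ _ => rfl)

/-- The embedding of the vertices of a deleted graph. -/
def emb (s : Finset V) : {v : V // v ∉ s} ↪ V := ⟨Subtype.val, Subtype.val_injective⟩

theorem delta_apply (T : Finset V) (i j : V) :
    delta T i j = if i = j then (if i ∈ T then 1 else 0) else 0 := by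
  simp [delta, Matrix.diagonal_apply]

theorem nullity_delete (H : MarkedGraph V) (s : Finset V) (S : Finset {v : V // v ∉ s}) :
    nullity ((H.delete s).subMat S) =
      nl (H.adj + delta (S.map (emb s))) (H.keep (S.map (emb s)) \ s) := by
  have hd : ∀ i j : {v : V // v ∉ s}, ((H.delete s).adj + delta S) i j =
      (H.adj + delta (S.map (emb s))) i.1 j.1 := by
    intro i j
    have : (i.1 ∈ S.map (emb s)) ↔ i ∈ S := by
      have := Finset.mem_map' (emb s) (a := i) (s := S)
      exact this
    rw [Matrix.add_apply, Matrix.add_apply, delta_apply, delta_apply]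
    simp only [this, Subtype.ext_iff]
    rfl
  refine nullity_sub (fun i : (H.delete s).keep S => (i.1.1 : V)) ?_ _ _ ?_ _ ?_
  · intro a b h
    exact Subtype.ext (Subtype.ext h)
  · intro i
    have hk : ∀ a : {v : V // v ∉ s}, a ∈ (H.delete s).keep S ↔
        a.1 ∈ H.keep (S.map (emb s)) := by
      intro a
      simp only [keep, Finset.mem_filter, Finset.mem_univ, true_and, hd]
      rfl
    constructor
    · intro hi
      rw [Finset.mem_sdiff] at hi
      exact ⟨⟨⟨i, hi.2⟩, (hk _).2 hi.1⟩, rfl⟩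
    · rintro ⟨a, rfl⟩
      rw [Finset.mem_sdiff]
      exact ⟨(hk _).1 a.2, a.1.2⟩
  · intro i j
    exact hd i.1 j.1

/-- State sum over a subset, evaluated. -/
theorem reducedBracket_eq (G : MarkedGraph V) :
    G.reducedBracket = (-LaurentPolynomial.T 2 - LaurentPolynomial.T (-2)) ^ G.freeLoops *
      ∑ T : Finset V, LaurentPolynomial.T 1 ^ (Fintype.card V - T.card) *
        LaurentPolynomial.T (-1) ^ T.card *
        (-LaurentPolynomial.T 2 - LaurentPolynomial.T (-2)) ^ nullity (G.subMat T) := by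
  unfold reducedBracket bracket
  simp only [map_mul, map_pow, map_sum, MvPolynomial.aeval_X]
  rfl

theorem reducedBracket_delete (H : MarkedGraph V) (s : Finset V) :
    (H.delete s).reducedBracket =
      (-LaurentPolynomial.T 2 - LaurentPolynomial.T (-2)) ^ H.freeLoops *
      ∑ t ∈ (Finset.univ \ s).powerset,
        LaurentPolynomial.T 1 ^ ((Finset.univ \ s).card - t.card) *
        LaurentPolynomial.T (-1) ^ t.card *
        (-LaurentPolynomial.T 2 - LaurentPolynomial.T (-2)) ^
          nl (H.adj + delta t) (H.keep t \ s) := by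
  rw [reducedBracket_eq]
  have hc : Fintype.card {v : V // v ∉ s} = (Finset.univ \ s).card := by
    rw [Fintype.card_subtype]
    congr 1
    ext i
    simp
  congr 1
  refine Finset.sum_bij (fun S _ => S.map (emb s)) ?_ ?_ ?_ ?_
  · intro S _
    rw [Finset.mem_powerset]
    intro i hi
    obtain ⟨a, _, rfl⟩ := Finset.mem_map.1 hi
    exact Finset.mem_sdiff.2 ⟨Finset.mem_univ _, a.2⟩
  · intro a _ b _ h
    exact Finset.map_injective _ h
  · intro t ht
    rw [Finset.mem_powerset] at ht
    refine ⟨t.subtype _, Finset.mem_univ _, ?_⟩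
    ext i
    simp only [Finset.mem_map, Finset.mem_subtype]
    constructor
    · rintro ⟨a, ha, rfl⟩
      exact ha
    · intro hi
      have := ht hi
      exact ⟨⟨i, by simpa using this⟩, hi, rfl⟩
  · intro S _
    rw [nullity_delete, Finset.card_map, hc]

theorem reduce_step (G : MarkedGraph V) (hsym : G.adj.IsSymm) (v w : V) (hvw : v ≠ w)
    (hadj : G.adj v w = 1)
    (hv : G.adj v v = 1) (hmv : G.marked v = true)
    (hw : G.adj w w = 0) (hmw : G.marked w = false)
    (honly : ∀ x, G.nbr w x → x = v) :
    G.reducedBracket =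
      (-LaurentPolynomial.T 2 - LaurentPolynomial.T (-2)) ^ G.freeLoops *
      ∑ t ∈ (Finset.univ \ {v, w}).powerset,
        LaurentPolynomial.T 1 ^ ((Finset.univ \ {v, w}).card - t.card) *
        LaurentPolynomial.T (-1) ^ t.card *
        (-LaurentPolynomial.T 2 - LaurentPolynomial.T (-2)) ^
          nl (G.adj + delta (insert v t)) (insert v (G.keep t \ {v, w})) := by
  have hwv : w ≠ v := hvw.symm
  have hadj' : G.adj w v = 1 := by rw [← hsym.apply]; exact hadj
  have hw0 : ∀ i, i ≠ v → G.adj w i = 0 := by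
    intro i hi
    by_contra h
    by_cases hiw : i = w
    · subst hiw; exact h hw
    · have h1 : ∀ a : ZMod 2, a ≠ 0 → a = 1 := by decide
      exact hi (honly i ⟨hiw, h1 _ h⟩)
  have hw0' : ∀ i, i ≠ v → G.adj i w = 0 := by
    intro i hi
    rw [← hsym.apply]
    exact hw0 i hi
  rw [reducedBracket_eq]
  congr 1
  obtain ⟨U, hU⟩ : ∃ U : Finset V, U = Finset.univ \ {v, w} := ⟨_, rfl⟩
  rw [← hU]
  have hvU : v ∉ insert w U := by simp [hU, hvw]
  have hwU : w ∉ U := by simp [hU]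
  have huniv : (Finset.univ : Finset V) = insert v (insert w U) := by
    ext i
    simp only [hU, Finset.mem_univ, Finset.mem_insert, Finset.mem_sdiff,
      Finset.mem_singleton, true_iff, true_and]
    tauto
  have hcard : Fintype.card V = U.card + 2 := by
    rw [← Finset.card_univ, huniv, Finset.card_insert_of_notMem hvU,
      Finset.card_insert_of_notMem hwU]
  rw [← Finset.powerset_univ, huniv, Finset.sum_powerset_insert hvU,
    Finset.sum_powerset_insert hwU, Finset.sum_powerset_insert hwU, ← Finset.sum_add_distrib,
    ← Finset.sum_add_distrib, ← Finset.sum_add_distrib]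
  refine Finset.sum_congr rfl fun t ht => ?_
  rw [Finset.mem_powerset] at ht
  have hvt : v ∉ t := fun h => hvU (Finset.mem_insert_of_mem (ht h))
  have hwt : w ∉ t := fun h => hwU (ht h)
  have hle : t.card ≤ U.card := Finset.card_le_card ht
  obtain ⟨k, hk⟩ : ∃ k : Finset V, k = G.keep t \ {v, w} := ⟨_, rfl⟩
  have hvk : v ∉ k := by simp [hk]
  have hwk : w ∉ k := by simp [hk]
  have hkv : ∀ i ∈ k, i ≠ v := fun i hi h => hvk (h ▸ hi)
  have hkw : ∀ i ∈ k, i ≠ w := fun i hi h => hwk (h ▸ hi)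
  have K0 : G.keep t = insert w (insert v k) := by
    ext i
    simp only [hk, Finset.mem_insert, Finset.mem_sdiff, Finset.mem_singleton]
    by_cases h : i = v
    · subst h; simp [keep, delta_apply, hvt, hv]
    · by_cases h' : i = w
      · subst h'; simp [keep, hmw]
      · simp [h, h']
  have Kw : G.keep (insert w t) = insert w (insert v k) := by
    rw [← K0]
    ext i
    by_cases h : i = w
    · subst h; simp [keep, hmw]
    · simp [keep, delta_apply, h]
  have Kv : G.keep (insert v t) = insert w k := by
    ext i
    simp only [hk, Finset.mem_insert, Finset.mem_sdiff, Finset.mem_singleton]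
    by_cases h : i = v
    · subst h; simp [keep, delta_apply, hv, hmv, hvw, z2_self]
    · by_cases h' : i = w
      · subst h'; simp [keep, hmw]
      · simp [keep, delta_apply, h, h']
  have Kvw : G.keep (insert v (insert w t)) = insert w k := by
    rw [← Kv]
    ext i
    by_cases h : i = w
    · subst h; simp [keep, hmw]
    · simp [keep, delta_apply, h]
  have N0 : nullity (G.subMat t) = nl (G.adj + delta t) k := by
    rw [nullity_subMat, K0]
    apply nl_P2 _ _ _ _ _ hwv hwk hvk
    · simp [delta_apply, hw, hwt]
    · simp [delta_apply, hadj', hwv]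
    · simp [delta_apply, hadj, hvw]
    · intro i hi j hj
      simp [delta_apply, hw0 j (hkv j hj), hw0' i (hkv i hi), (hkw j hj).symm, hkw i hi]
  have Nw : nullity (G.subMat (insert w t)) = nl (G.adj + delta (insert v t)) (insert v k) := by
    rw [nullity_subMat, Kw]
    apply nl_P1
    · simp [hwk, hwv]
    · simp [delta_apply, hw]
    · intro i hi j hj
      rcases Finset.mem_insert.1 hi with hi | hi
      · rcases Finset.mem_insert.1 hj with hj | hj
        · simp [delta_apply, hi, hj, hadj, hadj', hvw, hwv, hvt]
        · simp [delta_apply, hi, hw0 j (hkv j hj), (hkv j hj).symm, (hkw j hj).symm]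
      · have e1 := hkv i hi
        have e2 := hkw i hi
        simp [delta_apply, e1, e2, hw0' i e1]
  have Nv : nullity (G.subMat (insert v t)) = nl (G.adj + delta t) k + 1 := by
    rw [nullity_subMat, Kv]
    apply nl_P0 _ _ _ _ hwk
    · simp [delta_apply, hw, hwv, hwt]
    · intro i hi
      simp [delta_apply, hw0 i (hkv i hi), (hkw i hi).symm]
    · intro i hi
      simp [delta_apply, hw0' i (hkv i hi), hkw i hi]
    · intro i hi j hj
      simp [delta_apply, hkv i hi]
  have Nvw : nullity (G.subMat (insert v (insert w t))) = nl (G.adj + delta t) k := by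
    rw [nullity_subMat, Kvw]
    apply nl_P1 _ _ _ _ hwk
    · simp [delta_apply, hw]
    · intro i hi j hj
      simp [delta_apply, hkv i hi, hkw i hi, hw0' i (hkv i hi)]
  rw [N0, Nw, Nv, Nvw, ← hk, hcard, Finset.card_insert_of_notMem hvt,
    Finset.card_insert_of_notMem hwt, Finset.card_insert_of_notMem (by simp [hvw, hvt]),
    Finset.card_insert_of_notMem hwt]
  have e0 : U.card + 2 - t.card = (U.card - t.card) + 2 := by omega
  have e1 : U.card + 2 - (t.card + 1) = (U.card - t.card) + 1 := by omega
  have e2 : U.card + 2 - (t.card + 1 + 1) = U.card - t.card := by omega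
  rw [e0, e1, e2]
  have hT : (LaurentPolynomial.T 1 * LaurentPolynomial.T (-1) : LaurentPolynomial ℤ) = 1 := by
    rw [← LaurentPolynomial.T_add]; simp
  have hA : (LaurentPolynomial.T 2 : LaurentPolynomial ℤ) = LaurentPolynomial.T 1 ^ 2 := by
    rw [LaurentPolynomial.T_pow]; simp
  have hB : (LaurentPolynomial.T (-2) : LaurentPolynomial ℤ) = LaurentPolynomial.T (-1) ^ 2 := by
    rw [LaurentPolynomial.T_pow]; simp
  rw [hA, hB]
  generalize (LaurentPolynomial.T 1 : LaurentPolynomial ℤ) = a at *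
  generalize (LaurentPolynomial.T (-1) : LaurentPolynomial ℤ) = b at *
  generalize nl (G.adj + delta t) k = n0
  generalize nl (G.adj + delta (insert v t)) (insert v k) = n1
  generalize U.card - t.card = m
  generalize t.card = l
  linear_combination (a ^ m * b ^ l * (-a ^ 2 - b ^ 2) ^ n1 +
    a ^ m * b ^ l * (-a ^ 2 - b ^ 2) ^ (n0 + 1)) * hT

theorem case1 (G : MarkedGraph V) (hsym : G.adj.IsSymm) (v w : V)
    (hv : G.adj v v = 1) (h : ∀ x, G.nbr v x → x = w) (t : Finset V) (hvt : v ∉ t) :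
    nl (G.adj + delta (insert v t)) (insert v (G.keep t \ {v, w})) =
      nl (G.adj + delta t) (G.keep t \ {v, w}) + 1 := by
  have hz : ∀ i, i ≠ v → i ≠ w → G.adj v i = 0 := by
    intro i h1 h2
    by_contra h0
    have e : ∀ a : ZMod 2, a ≠ 0 → a = 1 := by decide
    exact h2 (h i ⟨h1, e _ h0⟩)
  have hne : ∀ i ∈ G.keep t \ {v, w}, i ≠ v ∧ i ≠ w := by
    intro i hi
    simpa using (Finset.mem_sdiff.1 hi).2
  apply nl_P0
  · simp
  · simp [delta_apply, hv, z2_self]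
  · intro i hi
    obtain ⟨h1, h2⟩ := hne i hi
    simp [delta_apply, hz i h1 h2, h1.symm]
  · intro i hi
    obtain ⟨h1, h2⟩ := hne i hi
    rw [Matrix.add_apply, ← hsym.apply, hz i h1 h2]
    simp [delta_apply, h1]
  · intro i hi j hj
    obtain ⟨h1, h2⟩ := hne i hi
    simp [delta_apply, h1]

theorem pivot_entry (G : MarkedGraph V) (hsym : G.adj.IsSymm) (v z : V) (i j : V)
    (hiv : i ≠ v) (hiz : i ≠ z) (hjv : j ≠ v) (hjz : j ≠ z) :
    (G.markedPivot v z).adj i j =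
      G.adj i j + G.adj i v * G.adj z j + G.adj i z * G.adj v j := by
  rw [hsym.apply v i, hsym.apply z i]
  simp only [markedPivot, swapAdjacencies, pivot, Equiv.swap_apply_of_ne_of_ne hiv hiz,
    Equiv.swap_apply_of_ne_of_ne hjv hjz]
  by_cases hij : i = j
  · subst hij
    simp
    linear_combination - z2_self (G.adj v i * G.adj z i)
  · simp only [hij, hiv, hiz, hjv, hjz, false_and, or_self, if_false, ne_eq, not_false_eq_true,
      true_and, pivotCond, nbr]
    generalize G.adj i j = a
    generalize G.adj v i = b
    generalize G.adj v j = c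
    generalize G.adj z i = d
    generalize G.adj z j = e
    revert a b c d e
    decide

theorem pivot_diag (G : MarkedGraph V) (v z i : V) :
    (G.markedPivot v z).adj i i = G.adj i i := by
  simp [markedPivot, swapAdjacencies, pivot]

theorem pivot_z (G : MarkedGraph V) (v z : V) (i : V) (hvz : v ≠ z)
    (hiv : i ≠ v) (hiz : i ≠ z) :
    (G.markedPivot v z).adj z i = G.adj v i ∧ (G.markedPivot v z).adj i z = G.adj i v := by
  constructor <;>
  simp [markedPivot, swapAdjacencies, pivot, Equiv.swap_apply_of_ne_of_ne hiv hiz, hiv, hiz,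
    hiz.symm, hvz, hvz.symm]

theorem case2 (G : MarkedGraph V) (hsym : G.adj.IsSymm) (v w : V)
    (hv : G.adj v v = 1) (z : V) (hzw : z ≠ w) (hz : G.nbr v z) (t : Finset V) (hvt : v ∉ t) :
    nl (G.adj + delta (insert v t)) (insert v (G.keep t \ {v, w})) =
      nl ((G.markedPivot v z).adj + delta t) ((G.markedPivot v z).keep t \ {v, w}) := by
  obtain ⟨hzv, hz1⟩ := hz
  have hvz : v ≠ z := hzv.symm
  have hz1' : G.adj z v = 1 := by rw [← hsym.apply]; exact hz1
  obtain ⟨k, hk⟩ : ∃ k : Finset V, k = G.keep t \ {v, w, z} := ⟨_, rfl⟩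
  have hne : ∀ i ∈ k, i ≠ v ∧ i ≠ w ∧ i ≠ z := by
    intro i hi
    rw [hk] at hi
    simpa using (Finset.mem_sdiff.1 hi).2
  have hvk : v ∉ k := fun h => (hne v h).1 rfl
  have hzk : z ∉ k := fun h => (hne z h).2.2 rfl
  obtain ⟨H, hH⟩ : ∃ H, H = G.markedPivot v z := ⟨_, rfl⟩
  rw [← hH]
  have hHd : ∀ i, H.adj i i = G.adj i i := fun i => hH ▸ pivot_diag G v z i
  have hHm : ∀ i, i ≠ v → i ≠ z → H.marked i = G.marked i := by
    intro i h1 h2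
    simp [hH, markedPivot, h1, h2]
  have hHmz : H.marked z = !G.marked z := by simp [hH, markedPivot]
  have hHz : ∀ i ∈ k, H.adj z i = G.adj v i ∧ H.adj i z = G.adj i v := fun i hi =>
    hH ▸ pivot_z G v z i hvz (hne i hi).1 (hne i hi).2.2
  have hHe : ∀ i ∈ k, ∀ j ∈ k, H.adj i j =
      G.adj i j + G.adj i v * G.adj z j + G.adj i z * G.adj v j := fun i hi j hj =>
    hH ▸ pivot_entry G hsym v z i j (hne i hi).1 (hne i hi).2.2 (hne j hj).1 (hne j hj).2.2
  have hkG : z ∈ G.keep t → G.keep t \ {v, w} = insert z k := by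
    intro h
    ext i
    simp only [hk, Finset.mem_insert, Finset.mem_sdiff, Finset.mem_singleton]
    by_cases hi : i = z
    · subst hi; simp [h, hzv, hzw]
    · simp [hi]
  have hkG' : z ∉ G.keep t → G.keep t \ {v, w} = k := by
    intro h
    ext i
    simp only [hk, Finset.mem_insert, Finset.mem_sdiff, Finset.mem_singleton]
    by_cases hi : i = z
    · subst hi; simp [h]
    · simp [hi]
  have hHk : ∀ i, i ≠ v → i ≠ z → (i ∈ H.keep t ↔ i ∈ G.keep t) := by
    intro i h1 h2
    simp [keep, hHm i h1 h2, hHd]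
  have hkH : z ∈ H.keep t → H.keep t \ {v, w} = insert z k := by
    intro h
    ext i
    simp only [hk, Finset.mem_insert, Finset.mem_sdiff, Finset.mem_singleton]
    by_cases hi : i = z
    · subst hi; simp [h, hzv, hzw]
    · by_cases hi' : i = v
      · simp [hi', hvz]
      · simp [hi, hi', hHk i hi' hi]
  have hkH' : z ∉ H.keep t → H.keep t \ {v, w} = k := by
    intro h
    ext i
    simp only [hk, Finset.mem_insert, Finset.mem_sdiff, Finset.mem_singleton]
    by_cases hi : i = z
    · subst hi; simp [h]
    · by_cases hi' : i = v
      · simp [hi']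
      · simp [hi, hi', hHk i hi' hi]
  have hDvv : (G.adj + delta (insert v t)) v v = 0 := by simp [delta_apply, hv, z2_self]
  have hDzz : (G.adj + delta (insert v t)) z z = (G.adj + delta t) z z := by
    simp [delta_apply, hzv]
  have hHzz : (H.adj + delta t) z z = (G.adj + delta t) z z := by simp [hHd]
  have hDvz : (G.adj + delta (insert v t)) v z = 1 := by simp [delta_apply, hvz, hz1]
  have hDzv : (G.adj + delta (insert v t)) z v = 1 := by simp [delta_apply, hzv, hz1']
  have z2 : ∀ a : ZMod 2, a = 0 ∨ a = 1 := by decide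
  rcases z2 ((G.adj + delta t) z z) with ha | ha
  · cases hm : G.marked z
    · have h1 : z ∈ G.keep t := by simp [keep, hm]
      have h2 : z ∉ H.keep t := by
        simp only [keep, Finset.mem_filter, hHmz, hm, hHzz, ha]
        simp
      rw [hkG h1, hkH' h2]
      apply nl_P2 _ _ _ _ _ hvz hvk hzk hDvv hDvz hDzv
      intro i hi j hj
      rw [hDzz, ha]
      obtain ⟨i1, i2, i3⟩ := hne i hi
      obtain ⟨j1, j2, j3⟩ := hne j hj
      simp [delta_apply, hHe i hi j hj, i1, i3, j1.symm, j3.symm]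
      ring
    · have h1 : z ∉ G.keep t := by
        simp only [keep, Finset.mem_filter, hm, ha]
        simp
      have h2 : z ∈ H.keep t := by simp [keep, hm, hHmz]
      rw [hkG' h1, hkH h2]
      apply nl_P3 _ _ _ _ _ hvz hvk hzk (fun j => G.adj z j) (fun i => G.adj i z) hDvv
      · rw [hHzz, ha]
      · intro i hi
        obtain ⟨i1, i2, i3⟩ := hne i hi
        simp [delta_apply, (hHz i hi).1, i1.symm, i3.symm]
      · intro i hi
        obtain ⟨i1, i2, i3⟩ := hne i hi
        simp [delta_apply, (hHz i hi).2, i1, i3]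
      · intro i hi j hj
        obtain ⟨i1, i2, i3⟩ := hne i hi
        obtain ⟨j1, j2, j3⟩ := hne j hj
        simp [delta_apply, hHe i hi j hj, i1, i3, j1.symm, j3.symm]
        ring
  · have h1 : z ∈ G.keep t := by
      simp only [keep, Finset.mem_filter, ha]
      simp
    have h2 : z ∈ H.keep t := by
      simp only [keep, Finset.mem_filter, hHzz, ha]
      simp
    rw [hkG h1, hkH h2]
    rw [nl_P1 (H.adj + delta t) ((H.adj + delta t) + Matrix.of fun i j =>
      (H.adj + delta t) i z * (H.adj + delta t) z j) k z hzk (by rw [hHzz, ha])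
      (fun i _ j _ => rfl)]
    apply nl_P2 _ _ _ _ _ hvz hvk hzk hDvv hDvz hDzv
    intro i hi j hj
    rw [hDzz, ha]
    obtain ⟨i1, i2, i3⟩ := hne i hi
    obtain ⟨j1, j2, j3⟩ := hne j hj
    simp [delta_apply, hHe i hi j hj, i1, i3, j1.symm, j3.symm, (hHz i hi).2, (hHz j hj).1]
    ring

end helpers

end MarkedGraph
/-- Suppose `v` and `w` are adjacent, `v` looped and marked, `w`
neither looped nor marked, and `v` is the only neighbor of `w`.  If `v` has no
neighbor other than `w` then `⟨G⟩ = ⟨G⁺ - v - w⟩`; otherwise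
`⟨G⟩ = ⟨G_c^{vz} - v - w⟩` for any neighbor `z ≠ w` of `v`. -/
theorem reducedBracket_omega2b {V : Type} [Fintype V] [DecidableEq V]
    (G : MarkedGraph V) (hsym : G.adj.IsSymm) (v w : V) (hvw : v ≠ w)
    (hadj : G.adj v w = 1)
    (hv : G.adj v v = 1) (hmv : G.marked v = true)
    (hw : G.adj w w = 0) (hmw : G.marked w = false)
    (honly : ∀ x, G.nbr w x → x = v) :
    ((∀ x, G.nbr v x → x = w) →
        G.reducedBracket = (G.addFreeLoop.delete {v, w}).reducedBracket) ∧
      (∀ z, z ≠ w → G.nbr v z →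
        G.reducedBracket = ((G.markedPivot v z).delete {v, w}).reducedBracket) := by
  rw [MarkedGraph.reduce_step G hsym v w hvw hadj hv hmv hw hmw honly]
  have hvt : ∀ t ∈ (Finset.univ \ {v, w} : Finset V).powerset, v ∉ t := by
    intro t ht h
    have := Finset.mem_powerset.1 ht h
    simp at this
  refine ⟨fun h => ?_, fun z hzw hz => ?_⟩
  · rw [MarkedGraph.reducedBracket_delete]
    change _ = _ ^ (G.freeLoops + 1) * _
    rw [pow_succ, mul_assoc, Finset.mul_sum _ _ (-LaurentPolynomial.T 2 - LaurentPolynomial.T (-2))]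
    congr 1
    refine Finset.sum_congr rfl fun t ht => ?_
    rw [MarkedGraph.case1 G hsym v w hv h t (hvt t ht), pow_succ]
    change _ = _ * (_ * _ ^ MarkedGraph.nl (G.adj + MarkedGraph.delta t) (G.keep t \ {v, w}))
    ring
  · rw [MarkedGraph.reducedBracket_delete]
    change _ = _ ^ G.freeLoops * _
    congr 1
    refine Finset.sum_congr rfl fun t ht => ?_
    rw [MarkedGraph.case2 G hsym v w hv z hzw hz t (hvt t ht)]
end
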